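/- Let m ∈ ℝ, v > 0, K > 0, set ξ = (m − log K)/sqrt(v), and for each natural number n define I_n = ∫_ℝ max(e^x − K, 0)·x^n·φ_{m,v}(x) dx and J_n = ∫_{−ξ}^{∞} (m + sqrt(v)·x)^n·φ(x) dx. Then I_0 = e^{m + v/2}·Φ(ξ + sqrt(v)) − K·Φ(ξ), I_1 = (m + v)·I_0 + K·v·J_0, and for every n ≥ 2: I_n = (m + v)·I_{n−1} + v·(n − 1)·I_{n−2} + K·v·J_{n−1}. -/

import Mathlib

/-- The standard normal density `φ(u) = (2π)^(-1/2) e^(-u²/2)`. -/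
noncomputable def stdNormalPDF (u : ℝ) : ℝ :=
  (Real.sqrt (2 * Real.pi))⁻¹ * Real.exp (-u ^ 2 / 2)

/-- The standard normal cumulative distribution function
`Φ(t) = ∫_{-∞}^t (2π)^(-1/2) e^(-u²/2) du`. -/
noncomputable def stdNormalCDF (t : ℝ) : ℝ :=
  ∫ u in Set.Iic t, (Real.sqrt (2 * Real.pi))⁻¹ * Real.exp (-u ^ 2 / 2)

/-- The Gaussian density with mean `m` and variance `v`:
`φ_{m,v}(x) = (2πv)^(-1/2) exp(-(x - m)²/(2v))`. -/
noncomputable def gaussianDens (m v x : ℝ) : ℝ :=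
  (Real.sqrt (2 * Real.pi * v))⁻¹ * Real.exp (-(x - m) ^ 2 / (2 * v))

open MeasureTheory Set

theorem integrable_pow_mul_gaussianDens (m : ℝ) {v : ℝ} (hv : 0 < v) (n : ℕ) :
    Integrable (fun x : ℝ => x ^ n * gaussianDens m v x) := by
  lift v to NNReal using hv.le
  have hv0 : v ≠ 0 := by
    rintro rfl
    simp at hv
  have h : Integrable (fun x : ℝ => x ^ n) (ProbabilityTheory.gaussianReal m v) :=
    ProbabilityTheory.integrable_pow_of_mem_interior_integrableExpSet (X := id) (by simp) n
  rw [ProbabilityTheory.gaussianReal_of_var_ne_zero m hv0,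
    integrable_withDensity_iff (ProbabilityTheory.measurable_gaussianPDF m v)
      (ae_of_all _ fun _ => ProbabilityTheory.gaussianPDF_lt_top)] at h
  simp only [ProbabilityTheory.toReal_gaussianPDF] at h
  exact h

theorem integrable_gaussianDens (m : ℝ) {v : ℝ} (hv : 0 < v) : Integrable (gaussianDens m v) := by
  simpa using integrable_pow_mul_gaussianDens m hv 0

theorem exp_mul_gaussianDens (m : ℝ) {v : ℝ} (hv : 0 < v) (x : ℝ) :
    Real.exp x * gaussianDens m v x = Real.exp (m + v / 2) * gaussianDens (m + v) v x := by
  unfold gaussianDens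
  have h : Real.exp x * Real.exp (-(x - m) ^ 2 / (2 * v)) =
      Real.exp (m + v / 2) * Real.exp (-(x - (m + v)) ^ 2 / (2 * v)) := by
    rw [← Real.exp_add, ← Real.exp_add]
    congr 1
    field_simp
    ring
  linear_combination (Real.sqrt (2 * Real.pi * v))⁻¹ * h

theorem hasDerivAt_gaussianDens (m : ℝ) {v : ℝ} (hv : 0 < v) (x : ℝ) :
    HasDerivAt (gaussianDens m v) (-((x - m) / v) * gaussianDens m v x) x := by
  unfold gaussianDens
  have h : HasDerivAt (fun x : ℝ => -(x - m) ^ 2 / (2 * v)) (-((x - m) / v)) x := by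
    have := ((((hasDerivAt_id x).sub_const m).pow 2).neg).div_const (2 * v)
    refine this.congr_deriv ?_
    simp only [id_eq]
    field_simp
    norm_num [mul_comm]
  refine ((h.exp).const_mul (Real.sqrt (2 * Real.pi * v))⁻¹).congr_deriv ?_
  ring

theorem sqrt_mul_gaussianDens (m : ℝ) {v : ℝ} (hv : 0 < v) (x : ℝ) :
    Real.sqrt v * gaussianDens m v (m + Real.sqrt v * x) = stdNormalPDF x := by
  unfold gaussianDens stdNormalPDF
  have hs : Real.sqrt v ≠ 0 := (Real.sqrt_pos.2 hv).ne'
  have he : -(m + Real.sqrt v * x - m) ^ 2 / (2 * v) = -x ^ 2 / 2 := by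
    rw [add_sub_cancel_left, mul_pow, Real.sq_sqrt hv.le]
    field_simp
  rw [he, Real.sqrt_mul (by positivity) v]
  field_simp

theorem setIntegral_comp_affine_mul_stdNormalPDF (f : ℝ → ℝ) (m : ℝ) {v : ℝ} (hv : 0 < v)
    (a : ℝ) :
    ∫ x in Ioi a, f (m + Real.sqrt v * x) * stdNormalPDF x =
      ∫ x in Ioi (m + Real.sqrt v * a), f x * gaussianDens m v x := by
  have hs : 0 < Real.sqrt v := Real.sqrt_pos.2 hv
  have hinj : Function.Injective (fun x : ℝ => m + Real.sqrt v * x) := fun x y h =>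
    mul_left_cancel₀ hs.ne' (add_left_cancel h)
  have himg : (fun x : ℝ => m + Real.sqrt v * x) '' Ioi a = Ioi (m + Real.sqrt v * a) := by
    ext y
    constructor
    · rintro ⟨x, hx, rfl⟩
      exact (add_lt_add_iff_left m).2 (mul_lt_mul_of_pos_left hx hs)
    · intro hy
      refine ⟨(y - m) / Real.sqrt v, ?_, ?_⟩
      · rw [mem_Ioi, lt_div_iff₀ hs]
        have := mem_Ioi.1 hy
        linarith
      · field_simp
        ring
  rw [← himg, integral_image_eq_integral_abs_deriv_smul measurableSet_Ioi
    (f' := fun _ => Real.sqrt v)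
    (fun x _ => by
      simpa using (((hasDerivAt_id x).const_mul (Real.sqrt v)).const_add m).hasDerivWithinAt)
    hinj.injOn]
  refine integral_congr_ae (ae_of_all _ fun x => ?_)
  simp only [smul_eq_mul, abs_of_pos hs, ← sqrt_mul_gaussianDens m hv x]
  ring

theorem setIntegral_Ioi_stdNormalPDF (t : ℝ) :
    ∫ x in Ioi (-t), stdNormalPDF x = stdNormalCDF t := by
  rw [← integral_comp_neg_Iic]
  simp [stdNormalPDF, stdNormalCDF]

theorem setIntegral_Ioi_gaussianDens (m : ℝ) {v : ℝ} (hv : 0 < v) (t : ℝ) :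
    ∫ x in Ioi (m - Real.sqrt v * t), gaussianDens m v x = stdNormalCDF t := by
  have h := setIntegral_comp_affine_mul_stdNormalPDF (fun _ => 1) m hv (-t)
  simp only [one_mul, mul_neg, ← sub_eq_add_neg] at h
  rw [← h, setIntegral_Ioi_stdNormalPDF]

theorem integrable_exp_mul_pow_mul_gaussianDens (m : ℝ) {v : ℝ} (hv : 0 < v) (n : ℕ) :
    Integrable (fun x : ℝ => Real.exp x * (x ^ n * gaussianDens m v x)) := by
  convert (integrable_pow_mul_gaussianDens (m + v) hv n).const_mul (Real.exp (m + v / 2))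
    using 2 with x
  linear_combination x ^ n * exp_mul_gaussianDens m hv x

theorem integrable_exp_sub_mul_pow_mul_gaussianDens (m : ℝ) {v : ℝ} (hv : 0 < v) (K : ℝ)
    (n : ℕ) : Integrable (fun x : ℝ => (Real.exp x - K) * x ^ n * gaussianDens m v x) := by
  convert (integrable_exp_mul_pow_mul_gaussianDens m hv n).sub
    ((integrable_pow_mul_gaussianDens m hv n).const_mul K) using 2 with x
  simp only [Pi.sub_apply]
  ring

theorem integral_callPayoff_mul_pow_mul_gaussianDens (m v : ℝ) {K : ℝ} (hK : 0 < K) (n : ℕ) :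
    ∫ x : ℝ, max (Real.exp x - K) 0 * x ^ n * gaussianDens m v x =
      ∫ x in Ioi (Real.log K), (Real.exp x - K) * x ^ n * gaussianDens m v x := by
  rw [← integral_indicator measurableSet_Ioi]
  congr 1
  ext x
  by_cases hx : Real.log K < x
  · have : K < Real.exp x := (Real.log_lt_iff_lt_exp hK).1 hx
    rw [indicator_of_mem (mem_Ioi.2 hx), max_eq_left (by linarith)]
  · have : Real.exp x ≤ K := (Real.le_log_iff_exp_le hK).1 (not_lt.1 hx)
    rw [indicator_of_notMem (by simpa using hx), max_eq_right (by linarith)]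
    simp

theorem setIntegral_exp_sub_mul_pow_succ_mul_gaussianDens (m : ℝ) {v K : ℝ} (hv : 0 < v)
    (hK : 0 < K) (n : ℕ) :
    ∫ x in Ioi (Real.log K), (Real.exp x - K) * x ^ (n + 1) * gaussianDens m v x =
      (m + v) * (∫ x in Ioi (Real.log K), (Real.exp x - K) * x ^ n * gaussianDens m v x) +
      v * n * (∫ x in Ioi (Real.log K), (Real.exp x - K) * x ^ (n - 1) * gaussianDens m v x) +
      K * v * ∫ x in Ioi (Real.log K), x ^ n * gaussianDens m v x := by
  set F : ℕ → ℝ → ℝ := fun n x => (Real.exp x - K) * x ^ n * gaussianDens m v x with hF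
  set G : ℝ → ℝ := fun x => x ^ n * gaussianDens m v x with hG
  have hFi : ∀ k, IntegrableOn (F k) (Ioi (Real.log K)) := fun k =>
    (integrable_exp_sub_mul_pow_mul_gaussianDens m hv K k).integrableOn
  have hGi : IntegrableOn G (Ioi (Real.log K)) :=
    (integrable_pow_mul_gaussianDens m hv n).integrableOn
  have hA := (hFi n).const_mul ((m + v) / v)
  have hB := (hFi (n - 1)).const_mul (n : ℝ)
  have hC := hGi.const_mul K
  have hD := (hFi (n + 1)).const_mul v⁻¹
  have hderiv : ∀ x, HasDerivAt (F n)
      ((m + v) / v * F n x + n * F (n - 1) x + K * G x - v⁻¹ * F (n + 1) x) x := by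
    intro x
    refine ((((Real.hasDerivAt_exp x).sub_const K).mul (hasDerivAt_pow n x)).mul
      (hasDerivAt_gaussianDens m hv x)).congr_deriv ?_
    simp only [hF, hG, Pi.mul_apply]
    field_simp
    ring
  have hAB : IntegrableOn (fun x => (m + v) / v * F n x + n * F (n - 1) x)
      (Ioi (Real.log K)) := hA.add hB
  have hABC : IntegrableOn (fun x => (m + v) / v * F n x + n * F (n - 1) x + K * G x)
      (Ioi (Real.log K)) := hAB.add hC
  have hint : IntegrableOn (fun x => (m + v) / v * F n x + n * F (n - 1) x + K * G x -
      v⁻¹ * F (n + 1) x) (Ioi (Real.log K)) := hABC.sub hD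
  have hlim := tendsto_zero_of_hasDerivAt_of_integrableOn_Ioi (fun x _ => hderiv x) hint (hFi n)
  have h := integral_Ioi_of_hasDerivAt_of_tendsto' (fun x _ => hderiv x) hint hlim
  rw [integral_sub hABC hD, integral_add hAB hC, integral_add hA hB] at h
  simp only [integral_const_mul] at h
  have h0 : F n (Real.log K) = 0 := by simp [hF, Real.exp_log hK]
  rw [h0] at h
  field_simp at h
  linear_combination -h

/-- Recursion for the weighted call-payoff moments
`I_n = ∫_ℝ max(eˣ - K, 0) xⁿ φ_{m,v}(x) dx`, with
`J_n = ∫_{-ξ}^∞ (m + sqrt(v) x)ⁿ φ(x) dx` and `ξ = (m - log K)/sqrt v`: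
`I_0 = e^{m + v/2} Φ(ξ + sqrt v) - K Φ(ξ)`, `I_1 = (m + v) I_0 + K v J_0`, and for
`n ≥ 2`, `I_n = (m + v) I_{n-1} + v (n - 1) I_{n-2} + K v J_{n-1}`. -/
theorem stmt_19 (m v K : ℝ) (hv : 0 < v) (hK : 0 < K)
    (ξ : ℝ) (hξ : ξ = (m - Real.log K) / Real.sqrt v)
    (I J : ℕ → ℝ)
    (hI : ∀ n : ℕ, I n = ∫ x : ℝ, max (Real.exp x - K) 0 * x ^ n * gaussianDens m v x)
    (hJ : ∀ n : ℕ, J n = ∫ x in Set.Ioi (-ξ), (m + Real.sqrt v * x) ^ n * stdNormalPDF x) :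
    I 0 = Real.exp (m + v / 2) * stdNormalCDF (ξ + Real.sqrt v) - K * stdNormalCDF ξ ∧
    I 1 = (m + v) * I 0 + K * v * J 0 ∧
    ∀ n : ℕ, 2 ≤ n →
      I n = (m + v) * I (n - 1) + v * ((n : ℝ) - 1) * I (n - 2) + K * v * J (n - 1) := by
  have hs : 0 < Real.sqrt v := Real.sqrt_pos.2 hv
  have hL : m - Real.sqrt v * ξ = Real.log K := by
    rw [hξ]
    field_simp
    ring
  have hL' : (m + v) - Real.sqrt v * (ξ + Real.sqrt v) = Real.log K := by
    rw [← hL]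
    linear_combination -(Real.mul_self_sqrt hv.le)
  have hrec : ∀ n : ℕ, I (n + 1) = (m + v) * I n + v * n * I (n - 1) + K * v * J n := by
    intro n
    rw [hJ, setIntegral_comp_affine_mul_stdNormalPDF (fun x => x ^ n) m hv, mul_neg,
      ← sub_eq_add_neg, hL]
    simp only [hI, integral_callPayoff_mul_pow_mul_gaussianDens m v hK]
    exact setIntegral_exp_sub_mul_pow_succ_mul_gaussianDens m hv hK n
  refine ⟨?_, ?_, ?_⟩
  · have h₁ := setIntegral_Ioi_gaussianDens m hv ξ
    have h₂ := setIntegral_Ioi_gaussianDens (m + v) hv (ξ + Real.sqrt v)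
    rw [hL] at h₁
    rw [hL'] at h₂
    rw [hI, integral_callPayoff_mul_pow_mul_gaussianDens m v hK, ← h₁, ← h₂,
      ← integral_const_mul, ← integral_const_mul, ← integral_sub]
    · refine integral_congr_ae (ae_of_all _ fun x => ?_)
      simp only [← exp_mul_gaussianDens m hv x]
      ring
    · exact ((integrable_gaussianDens (m + v) hv).const_mul _).integrableOn
    · exact ((integrable_gaussianDens m hv).const_mul _).integrableOn
  · simpa using hrec 0
  · intro n hn
    obtain ⟨k, rfl⟩ := Nat.exists_eq_add_of_le' hn
    have h := hrec (k + 1)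
    push_cast at h ⊢
    linear_combination h
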